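/- Let V be a k-dimensional vector space over a field and u ∈ SL(V) (an invertible linear map with ⋀^k u = id on ⋀^k V). Then for any a, any x ∈ ⋀^a V, any y ∈ ⋀^{k−a} V, and any m ∈ ℕ: x ∧ ((⋀^{k−a}(u^{−1}) − id)^m (y)) = ((⋀^a u − id)^m (x)) ∧ y, as elements of ⋀^k V. -/

import Mathlib

open ExteriorAlgebra

/-- The `n`-th graded piece `⋀^n V` of the exterior algebra: the span of all wedges of
`n` vectors. -/
noncomputable def gradePiece (F V : Type*) [Field F] [AddCommGroup V] [Module F V]
    (n : ℕ) : Submodule F (ExteriorAlgebra F V) :=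
  Submodule.span F
    (Set.range fun v : Fin n → V => (List.ofFn fun i => ExteriorAlgebra.ι F (v i)).prod)

theorem gradePiece_eq_exteriorPower (F V : Type*) [Field F] [AddCommGroup V] [Module F V]
    (n : ℕ) : gradePiece F V n = ⋀[F]^n V := by
  rw [← ExteriorAlgebra.ιMulti_span_fixedDegree, gradePiece]
  rfl

theorem mul_mem_gradePiece {F V : Type*} [Field F] [AddCommGroup V] [Module F V] {i j : ℕ}
    {x y : ExteriorAlgebra F V} (hx : x ∈ gradePiece F V i) (hy : y ∈ gradePiece F V j) :
    x * y ∈ gradePiece F V (i + j) := by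
  rw [gradePiece_eq_exteriorPower] at *
  exact SetLike.mul_mem_graded hx hy

theorem map_mem_gradePiece {F V W : Type*} [Field F] [AddCommGroup V] [Module F V]
    [AddCommGroup W] [Module F W] (f : V →ₗ[F] W) {n : ℕ} {x : ExteriorAlgebra F V}
    (hx : x ∈ gradePiece F V n) : ExteriorAlgebra.map f x ∈ gradePiece F W n := by
  induction hx using Submodule.span_induction with
  | mem x hx =>
    obtain ⟨v, rfl⟩ := hx
    refine Submodule.subset_span ⟨f ∘ v, ?_⟩
    simp [map_list_prod, List.map_ofFn, Function.comp_def]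
  | zero => simp
  | add x y _ _ hx hy => simpa using add_mem hx hy
  | smul c x _ hx => simpa using Submodule.smul_mem _ c hx

theorem mul_map_symm_eq_map_mul {F V : Type*} [Field F] [AddCommGroup V] [Module F V]
    {i j : ℕ} (u : V ≃ₗ[F] V)
    (hdet : ∀ z ∈ gradePiece F V (i + j), ExteriorAlgebra.map u.toLinearMap z = z)
    {x y : ExteriorAlgebra F V} (hx : x ∈ gradePiece F V i) (hy : y ∈ gradePiece F V j) :
    x * ExteriorAlgebra.map u.symm.toLinearMap y = ExteriorAlgebra.map u.toLinearMap x * y := by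
  have hinv : ExteriorAlgebra.map u.toLinearMap (ExteriorAlgebra.map u.symm.toLinearMap y) = y := by
    rw [← AlgHom.comp_apply, ExteriorAlgebra.map_comp_map]
    simp
  rw [← hdet _ (mul_mem_gradePiece hx (map_mem_gradePiece _ hy)), map_mul, hinv]

/-- For `u ∈ SL(V)` (i.e. `⋀^k u = id` on the top exterior power of the
`k`-dimensional space `V`), for `x ∈ ⋀^a V`, `y ∈ ⋀^{k−a} V` and any `m`:
`x ∧ ((⋀^{k−a} u⁻¹ − id)^m y) = ((⋀^a u − id)^m x) ∧ y` in `⋀^k V`. -/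
theorem stmt13 {F V : Type*} [Field F] [AddCommGroup V] [Module F V]
    [FiniteDimensional F V] (k a m : ℕ) (hk : Module.finrank F V = k) (ha : a ≤ k)
    (u : V ≃ₗ[F] V)
    (hdet : ∀ z ∈ gradePiece F V k, ExteriorAlgebra.map u.toLinearMap z = z)
    (x y : ExteriorAlgebra F V)
    (hx : x ∈ gradePiece F V a) (hy : y ∈ gradePiece F V (k - a)) :
    x * ((((ExteriorAlgebra.map u.symm.toLinearMap).toLinearMap - LinearMap.id :
        Module.End F (ExteriorAlgebra F V)) ^ m) y)
      = ((((ExteriorAlgebra.map u.toLinearMap).toLinearMap - LinearMap.id :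
        Module.End F (ExteriorAlgebra F V)) ^ m) x) * y := by
  obtain ⟨b, rfl⟩ := Nat.exists_eq_add_of_le ha
  rw [Nat.add_sub_cancel_left] at hy
  induction m generalizing x with
  | zero => simp
  | succ m ih =>
    have hmem := Module.End.pow_apply_mem_of_forall_mem
      (f' := (ExteriorAlgebra.map u.symm.toLinearMap).toLinearMap - LinearMap.id) m
      (fun z hz => sub_mem (map_mem_gradePiece u.symm.toLinearMap hz) hz) y hy
    have hx' := sub_mem (map_mem_gradePiece u.toLinearMap hx) hx
    rw [pow_succ', pow_succ, Module.End.mul_apply, Module.End.mul_apply]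
    refine Eq.trans ?_ (ih _ hx')
    simp only [LinearMap.sub_apply, AlgHom.toLinearMap_apply, LinearMap.id_apply, mul_sub, sub_mul]
    rw [mul_map_symm_eq_map_mul u hdet hx hmem]
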